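/- Let D be the number of (A,S)-derangements and E the number of permutations π of {1,…,n} such that π has no small cycle contained in an ascending block and, for each descending block, the total length of the small cycles of π contained in that block is even. Then E = a_1!⋯a_k!·D. -/

import Mathlib

/-- Apply a permutation of `Fin n` to a natural number (0-based indexing);
indices `≥ n` are left fixed. -/
def appl {n : ℕ} (π : Equiv.Perm (Fin n)) (j : ℕ) : ℕ :=
  if h : j < n then ((π ⟨j, h⟩ : Fin n) : ℕ) else j

/-- The starting index (0-based) of the `i`-th consecutive block when
`{0,…,n-1}` is partitioned into blocks of sizes `a 0, …, a (k-1)`. -/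
def blockStart {k : ℕ} (a : Fin k → ℕ) (i : Fin k) : ℕ := ∑ t ∈ Finset.Iio i, a t

/-- `x` lies in the `i`-th block. -/
def inBlock {k : ℕ} (a : Fin k → ℕ) (i : Fin k) (x : ℕ) : Prop :=
  blockStart a i ≤ x ∧ x < blockStart a i + a i

instance {k : ℕ} (a : Fin k → ℕ) (i : Fin k) : DecidablePred (inBlock a i) := fun x =>
  inferInstanceAs (Decidable (blockStart a i ≤ x ∧ x < blockStart a i + a i))

/-- An `(a₁,…,a_k,S)`-permutation: a permutation of `{0,…,n-1}` (where `n = ∑ aᵢ`)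
that is strictly decreasing on each block `Aᵢ` with `i ∈ S` and strictly
increasing on each block `Aᵢ` with `i ∉ S`. -/
def IsASPerm {k : ℕ} (a : Fin k → ℕ) (S : Finset (Fin k))
    (π : Equiv.Perm (Fin (∑ t, a t))) : Prop :=
  ∀ i : Fin k, ∀ j : ℕ, blockStart a i ≤ j → j + 1 < blockStart a i + a i →
    if i ∈ S then appl π (j + 1) < appl π j else appl π j < appl π (j + 1)

/-- The number of `(a,S)`-derangements. -/
noncomputable def numDer (k : ℕ) (a : Fin k → ℕ) (S : Finset (Fin k)) : ℕ :=
  Nat.card {π : Equiv.Perm (Fin (∑ t, a t)) // IsASPerm a S π ∧ ∀ x, π x ≠ x}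

/-- The total length of the small cycles of `π` contained in block `i`:
fixed points in block `i` (small `1`-cycles) plus the support sizes of the
nontrivial cycle factors supported inside block `i`. -/
noncomputable def totalSmallLen {k : ℕ} (a : Fin k → ℕ) (i : Fin k)
    (π : Equiv.Perm (Fin (∑ t, a t))) : ℕ :=
  Nat.card {x : Fin (∑ t, a t) // π x = x ∧ inBlock a i (x : ℕ)} +
    ∑ c ∈ π.cycleFactorsFinset.filter
      (fun c : Equiv.Perm (Fin (∑ t, a t)) => ∀ x ∈ c.support, inBlock a i (x : ℕ)),
      c.support.card

section SmallCycles

open Finset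
open scoped Classical

/-- The elements of the cycles of `τ` all of whose entries have colour `i`. -/
noncomputable def smallSet {κ : Type*} {n : ℕ} (c : Fin n → κ) (τ : Equiv.Perm (Fin n)) (i : κ) :
    Finset (Fin n) :=
  {v | ∀ y, τ.SameCycle v y → c y = i}

/-- The condition on the total length `s` of the small cycles in block `i`. -/
def SmallCond {κ : Type*} (S : Finset κ) (i : κ) (s : ℕ) : Prop :=
  if i ∈ S then Even s else s = 0

/-- Permutations that satisfy the small cycle condition in each block of `T`. -/
noncomputable def evenPerms {κ : Type*} {n : ℕ} (S T : Finset κ) (c : Fin n → κ) :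
    Finset (Equiv.Perm (Fin n)) :=
  {τ | ∀ i ∈ T, SmallCond S i #(smallSet c τ i)}

section Perms

variable {κ : Type*} {n : ℕ}

theorem mem_smallSet_iff_exists_closed (c : Fin n → κ) (τ : Equiv.Perm (Fin n)) (i : κ)
    (v : Fin n) :
    v ∈ smallSet c τ i ↔ ∃ W : Set (Fin n), v ∈ W ∧ ∀ z ∈ W, c z = i ∧ τ z ∈ W := by
  simp only [smallSet, mem_filter, mem_univ, true_and]
  constructor
  · intro h
    refine ⟨{y | τ.SameCycle v y}, Equiv.Perm.SameCycle.refl _ _, fun z hz => ⟨h z hz, ?_⟩⟩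
    exact Equiv.Perm.sameCycle_apply_right.mpr hz
  · rintro ⟨W, hv, hW⟩ y hy
    obtain ⟨m, rfl⟩ := hy.exists_nat_pow_eq
    have key : ∀ m : ℕ, (τ ^ m) v ∈ W := by
      intro m
      induction m with
      | zero => simpa
      | succ m ih => rw [pow_succ', Equiv.Perm.mul_apply]; exact (hW _ ih).2
    exact (hW _ (key m)).1

theorem color_of_mem_smallSet {c : Fin n → κ} {τ : Equiv.Perm (Fin n)} {i : κ} {v : Fin n}
    (h : v ∈ smallSet c τ i) : c v = i := by
  simp only [smallSet, mem_filter, mem_univ, true_and] at h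
  exact h v (Equiv.Perm.SameCycle.refl _ _)

theorem apply_mem_smallSet {c : Fin n → κ} {τ : Equiv.Perm (Fin n)} {i : κ} {v : Fin n}
    (h : v ∈ smallSet c τ i) : τ v ∈ smallSet c τ i := by
  simp only [smallSet, mem_filter, mem_univ, true_and] at h ⊢
  exact fun y hy => h y (Equiv.Perm.sameCycle_apply_left.mp hy)

/-- Removing `x` from its cycle, while recording the image of `x`. -/
theorem exists_removal_equiv (x : Fin (n + 1)) :
    ∃ e : Equiv.Perm (Fin (n + 1)) ≃ Fin (n + 1) × Equiv.Perm (Fin n), ∀ τ,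
      (e τ).1 = τ x ∧ ∀ z, τ (x.succAbove z) =
        if x.succAbove ((e τ).2 z) = τ x then x else x.succAbove ((e τ).2 z) := by
  set F := finSuccEquiv' x with hF
  refine ⟨(F.permCongr.trans Equiv.Perm.decomposeOption).trans
    (Equiv.prodCongr F.symm (Equiv.refl _)), fun τ => ?_⟩
  obtain ⟨⟨y, σ⟩, rfl⟩ := (F.permCongr.trans Equiv.Perm.decomposeOption).symm.surjective τ
  have h0 : F x = none := finSuccEquiv'_at x
  have h1 : ∀ z, F (x.succAbove z) = some z := fun z => finSuccEquiv'_succAbove x z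
  have h2 : F.symm none = x := finSuccEquiv'_symm_none x
  have h3 : ∀ z, F.symm (some z) = x.succAbove z := fun z => finSuccEquiv'_symm_some x z
  have hx : ((F.permCongr.trans Equiv.Perm.decomposeOption).symm (y, σ)) x = F.symm y := by
    simp [Equiv.Perm.decomposeOption_symm_apply, h0]
  refine ⟨?_, fun z => ?_⟩
  · rw [hx]; simp
  · rw [hx]
    simp only [Equiv.trans_apply, Equiv.apply_symm_apply, Equiv.prodCongr_apply, Prod.map_snd,
      Equiv.refl_apply]
    have hz : ((F.permCongr.trans Equiv.Perm.decomposeOption).symm (y, σ)) (x.succAbove z) =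
        F.symm (Equiv.swap none y (some (σ z))) := by
      simp [Equiv.Perm.decomposeOption_symm_apply, h1]
    rw [hz, Equiv.swap_apply_def, ← h3, if_neg (Option.some_ne_none _)]
    simp only [EmbeddingLike.apply_eq_iff_eq]
    split_ifs <;> simp [h2]

variable {x : Fin (n + 1)} {τ : Equiv.Perm (Fin (n + 1))} {σ : Equiv.Perm (Fin n)}

theorem smallSet_removal_of_mem {c : Fin (n + 1) → κ} {i : κ}
    (h : ∀ z, τ (x.succAbove z) = if x.succAbove (σ z) = τ x then x else x.succAbove (σ z))
    (z : Fin n) (hz : x.succAbove z ∈ smallSet c τ i) :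
    z ∈ smallSet (c ∘ x.succAbove) σ i := by
  rw [mem_smallSet_iff_exists_closed] at hz ⊢
  obtain ⟨W, hzW, hW⟩ := hz
  refine ⟨{y | x.succAbove y ∈ W}, hzW, fun y hy => ⟨(hW _ hy).1, ?_⟩⟩
  have h' := h y
  have h1 := (hW _ hy).2
  simp only [Set.mem_ofPred_eq] at hy ⊢
  split_ifs at h' with h2
  · rw [h2]; rw [h'] at h1; exact (hW _ h1).2
  · rwa [← h']

theorem mem_smallSet_removal_iff {c : Fin (n + 1) → κ} {i : κ} (hx : c x = i)
    (h : ∀ z, τ (x.succAbove z) = if x.succAbove (σ z) = τ x then x else x.succAbove (σ z)) :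
    x ∈ smallSet c τ i ↔
      τ x = x ∨ ∃ y ∈ smallSet (c ∘ x.succAbove) σ i, τ x = x.succAbove y := by
  constructor
  · intro hm
    rcases Fin.eq_self_or_eq_succAbove x (τ x) with h1 | ⟨y, hy⟩
    · exact Or.inl h1
    · exact Or.inr ⟨y, smallSet_removal_of_mem h y (hy ▸ apply_mem_smallSet hm), hy⟩
  · intro hm
    rw [mem_smallSet_iff_exists_closed]
    refine ⟨insert x (x.succAbove '' (smallSet (c ∘ x.succAbove) σ i)), Set.mem_insert _ _, ?_⟩
    rintro z (rfl | ⟨z, hz, rfl⟩)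
    · refine ⟨hx, ?_⟩
      rcases hm with h1 | ⟨y, hy, h1⟩
      · rw [h1]; exact Set.mem_insert _ _
      · rw [h1]; exact Set.mem_insert_of_mem _ ⟨y, hy, rfl⟩
    · refine ⟨color_of_mem_smallSet (c := c ∘ x.succAbove) hz, ?_⟩
      rw [h z]
      split_ifs
      · exact Set.mem_insert _ _
      · exact Set.mem_insert_of_mem _ ⟨_, apply_mem_smallSet hz, rfl⟩

theorem succAbove_mem_smallSet_iff {c : Fin (n + 1) → κ} {i : κ}
    (h : ∀ z, τ (x.succAbove z) = if x.succAbove (σ z) = τ x then x else x.succAbove (σ z))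
    (hm : x ∈ smallSet c τ i) (j : κ) (z : Fin n) :
    x.succAbove z ∈ smallSet c τ j ↔ z ∈ smallSet (c ∘ x.succAbove) σ j := by
  refine ⟨smallSet_removal_of_mem h z, fun hz => ?_⟩
  rw [mem_smallSet_iff_exists_closed]
  refine ⟨(x.succAbove '' (smallSet (c ∘ x.succAbove) σ j)) ∪ {y | i = j ∧ y ∈ smallSet c τ i},
    Or.inl ⟨z, hz, rfl⟩, ?_⟩
  rintro y (⟨y, hy, rfl⟩ | ⟨rfl, hy⟩)
  · refine ⟨color_of_mem_smallSet (c := c ∘ x.succAbove) hy, ?_⟩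
    rw [h y]
    split_ifs with h1
    · refine Or.inr ⟨?_, hm⟩
      have h2 := color_of_mem_smallSet (c := c ∘ x.succAbove) (apply_mem_smallSet hy)
      have h3 := color_of_mem_smallSet (apply_mem_smallSet hm)
      rw [← h3, ← h1, ← h2]; rfl
    · exact Or.inl ⟨_, apply_mem_smallSet hy, rfl⟩
  · exact ⟨color_of_mem_smallSet hy, Or.inr ⟨rfl, apply_mem_smallSet hy⟩⟩

theorem Fin.card_filter_eq_add_succAbove (v : Fin (n + 1)) (p : Fin (n + 1) → Prop)
    [DecidablePred p] :
    #{u | p u} = (if p v then 1 else 0) + #{z | p (v.succAbove z)} := by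
  simp only [Finset.card_filter]
  rw [Fin.sum_univ_succAbove _ v]

theorem card_smallSet_of_mem {c : Fin (n + 1) → κ} {i : κ}
    (h : ∀ z, τ (x.succAbove z) = if x.succAbove (σ z) = τ x then x else x.succAbove (σ z))
    (hm : x ∈ smallSet c τ i) (j : κ) :
    #(smallSet c τ j) = (if j = i then 1 else 0) + #(smallSet (c ∘ x.succAbove) σ j) := by
  have h1 := Fin.card_filter_eq_add_succAbove x (fun u => u ∈ smallSet c τ j)
  simp only [succAbove_mem_smallSet_iff h hm, Finset.filter_univ_mem] at h1
  rw [h1]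
  congr 1
  by_cases hj : j = i
  · subst hj; simp [hm]
  · have : x ∉ smallSet c τ j := fun h' =>
      hj ((color_of_mem_smallSet h').symm.trans (color_of_mem_smallSet hm))
    simp [hj, this]

theorem card_perms_with_small_mem {c : Fin (n + 1) → κ} {i : κ} (S T : Finset κ) (hi : i ∉ T)
    (hx : c x = i) (s : ℕ) :
    #{τ ∈ evenPerms S T c | #(smallSet c τ i) = s + 1 ∧ x ∈ smallSet c τ i} =
      (s + 1) * #{σ ∈ evenPerms S T (c ∘ x.succAbove) |
        #(smallSet (c ∘ x.succAbove) σ i) = s} := by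
  obtain ⟨e, he⟩ := exists_removal_equiv (n := n) x
  have h1 : #{τ ∈ evenPerms S T c | #(smallSet c τ i) = s + 1 ∧ x ∈ smallSet c τ i} =
      #(({σ ∈ evenPerms S T (c ∘ x.succAbove) | #(smallSet (c ∘ x.succAbove) σ i) = s}).sigma
        fun σ => insert x ((smallSet (c ∘ x.succAbove) σ i).map (Fin.succAboveEmb x))) := by
    refine Finset.card_equiv (e.trans ((Equiv.prodComm _ _).trans (Equiv.sigmaEquivProd _ _).symm))
      fun τ => ?_
    obtain ⟨hy, hσ⟩ := he τ
    set σ := (e τ).2 with hσdef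
    have hmem := mem_smallSet_removal_iff (c := c) hx hσ
    have hmem' : x ∈ smallSet c τ i ↔ τ x ∈ insert x
        ((smallSet (c ∘ x.succAbove) σ i).map (Fin.succAboveEmb x)) := by
      rw [hmem]
      simp only [mem_insert, mem_map, eq_comm (a := τ x)]
      rfl
    have hrw : (e.trans ((Equiv.prodComm _ _).trans (Equiv.sigmaEquivProd _ _).symm)) τ =
        ⟨σ, τ x⟩ := by
      simp [← hy, hσdef]
    rw [hrw, mem_sigma, mem_filter, mem_filter, ← hmem', ← and_assoc]
    refine and_congr_left fun hm => ?_
    have hc := card_smallSet_of_mem hσ hm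
    simp only [evenPerms, mem_filter, mem_univ, true_and]
    refine and_congr (forall₂_congr fun j hj => ?_) ?_
    · rw [hc j, if_neg (fun h : j = i => hi (h ▸ hj)), zero_add]
    · rw [hc i, if_pos rfl]; omega
  rw [h1, Finset.card_sigma]
  rw [Finset.sum_congr rfl (g := fun _ => s + 1), Finset.sum_const, smul_eq_mul, mul_comm]
  intro σ hσ
  rw [mem_filter] at hσ
  rw [card_insert_of_notMem, card_map, hσ.2]
  simp only [mem_map, not_exists, not_and]
  intro z _ hz
  exact Fin.succAbove_ne x z hz

theorem card_perms_with_small_succ {c : Fin (n + 1) → κ} {c' : Fin n → κ} {i : κ}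
    (S T : Finset κ) (hi : i ∉ T) (hc : ∀ x, c x = i → c ∘ x.succAbove = c') (s : ℕ) :
    #{τ ∈ evenPerms S T c | #(smallSet c τ i) = s + 1} =
      #{x | c x = i} * #{σ ∈ evenPerms S T c' | #(smallSet c' σ i) = s} := by
  have h := Finset.sum_card_bipartiteAbove_eq_sum_card_bipartiteBelow
    (fun (τ : Equiv.Perm (Fin (n + 1))) x => x ∈ smallSet c τ i)
    (s := {τ ∈ evenPerms S T c | #(smallSet c τ i) = s + 1}) (t := {x | c x = i})
  simp only [bipartiteAbove, bipartiteBelow, filter_filter] at h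
  rw [Finset.sum_congr rfl (g := fun _ => s + 1), Finset.sum_const, smul_eq_mul,
    Finset.sum_congr (s₁ := {x | c x = i}) rfl (g := fun _ =>
      (s + 1) * #{σ ∈ evenPerms S T c' | #(smallSet c' σ i) = s}),
    Finset.sum_const, smul_eq_mul] at h
  · refine Nat.eq_of_mul_eq_mul_right (Nat.succ_pos s) (h.trans ?_)
    rw [Nat.succ_eq_add_one]
    ring
  · intro x hx
    have hx : c x = i := by simpa using hx
    rw [← hc x hx]
    exact card_perms_with_small_mem S T hi hx s
  · intro τ hτ
    rw [← (mem_filter.mp hτ).2]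
    congr 1
    ext v
    simp only [mem_filter, mem_univ, true_and, and_iff_right_iff_imp]
    exact color_of_mem_smallSet

theorem not_smallCond_iff (S : Finset κ) (i : κ) (s : ℕ) :
    ¬SmallCond S i s ↔ ∃ r, s = r + 1 ∧ (i ∈ S → SmallCond S i r) := by
  unfold SmallCond
  by_cases h : i ∈ S
  · simp only [h, if_true, true_imp_iff, Nat.not_even_iff_odd]
    constructor
    · rintro ⟨t, rfl⟩; exact ⟨2 * t, rfl, even_two_mul t⟩
    · rintro ⟨r, rfl, hr⟩; exact hr.add_one
  · simp only [h, if_false, false_imp_iff, and_true]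
    rw [Nat.exists_eq_add_one, Nat.pos_iff_ne_zero]

theorem card_evenPerms_recursion {c : Fin (n + 1) → κ} {c' : Fin n → κ} {i : κ}
    (S T : Finset κ) (hi : i ∉ T) (hc : ∀ x, c x = i → c ∘ x.succAbove = c') :
    #(evenPerms S T c) = #(evenPerms S (insert i T) c) +
      #{x | c x = i} * #(evenPerms S (if i ∈ S then insert i T else T) c') := by
  have hins : ∀ {m : ℕ} (d : Fin m → κ), evenPerms S (insert i T) d =
      {τ ∈ evenPerms S T d | SmallCond S i #(smallSet d τ i)} := by
    intro m d
    ext τ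
    simp [evenPerms, and_comm]
  rw [← Finset.card_filter_add_card_filter_not (s := evenPerms S T c)
    (fun τ => SmallCond S i #(smallSet c τ i)), ← hins]
  congr 1
  have h' : evenPerms S (if i ∈ S then insert i T else T) c' =
      {τ ∈ evenPerms S T c' | i ∈ S → SmallCond S i #(smallSet c' τ i)} := by
    split_ifs with h
    · rw [hins]; simp [h]
    · simp [h]
  rw [h']
  have hle : ∀ {m : ℕ} (d : Fin m → κ) τ, #(smallSet d τ i) ≤ m := fun d τ =>
    (card_le_univ _).trans (by simp)
  rw [Finset.card_eq_sum_card_fiberwise (f := fun σ => #(smallSet c' σ i))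
      (t := range (n + 1)) (fun σ _ => by simpa [Nat.lt_succ_iff] using hle c' σ),
    Finset.card_eq_sum_card_fiberwise (f := fun σ => #(smallSet c σ i))
      (t := range (n + 2)) (fun σ _ => by simpa [Nat.lt_succ_iff] using hle c σ),
    Finset.sum_range_succ', mul_sum]
  have h0 : ∀ τ, #(smallSet c τ i) = 0 → SmallCond S i #(smallSet c τ i) := by
    intro τ h; rw [h]; unfold SmallCond; simp
  rw [(Finset.card_eq_zero (s := filter _ _)).mpr, add_zero]
  · refine Finset.sum_congr rfl fun s _ => ?_
    have hs := card_perms_with_small_succ S T hi hc s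
    by_cases hq : i ∈ S → SmallCond S i s
    · convert hs using 2
      · rw [filter_filter]
        refine filter_congr fun τ _ => and_iff_right_of_imp fun h => ?_
        rw [h, not_smallCond_iff]; exact ⟨s, rfl, hq⟩
      · rw [filter_filter]
        congr 1
        refine filter_congr fun τ _ => and_iff_right_of_imp fun h => ?_
        rwa [h]
    · rw [(Finset.card_eq_zero (s := {τ ∈ {τ ∈ evenPerms S T c' | _} | _})).mpr, mul_zero,
        Finset.card_eq_zero]
      · rw [filter_filter, filter_eq_empty_iff]
        rintro τ - ⟨h1, h2⟩
        rw [h2, not_smallCond_iff] at h1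
        obtain ⟨r, hr, h1⟩ := h1
        obtain rfl : s = r := by omega
        exact hq h1
      · rw [filter_filter, filter_eq_empty_iff]
        rintro τ - ⟨h1, h2⟩
        exact hq (h2 ▸ h1)
  · rw [filter_filter, filter_eq_empty_iff]
    rintro τ - ⟨h1, h2⟩
    exact h1 (h0 τ h2)

end Perms

/-- For words `c` and `w` with the same content, `v` is a fixed point of the permutation that
sends the positions of each letter in `c` to its positions in `w`, order-reversingly for letters
in `S` and order-preservingly for the others. -/
def IsWordFix {κ : Type*} {n : ℕ} (S : Finset κ) (c w : Fin n → κ) (v : Fin n) : Prop :=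
  w v = c v ∧ if c v ∈ S then #{u | v < u ∧ w u = c v} = #{u | u < v ∧ c u = c v}
    else #{u | u < v ∧ w u = c v} = #{u | u < v ∧ c u = c v}

/-- Words with the content of `c` that have no fixed points in the blocks of `T`. -/
noncomputable def derWords {κ : Type*} [Fintype κ] {n : ℕ} (S T : Finset κ) (c : Fin n → κ) :
    Finset (Fin n → κ) :=
  {w | (∀ i, #{u | w u = i} = #{u | c u = i}) ∧ ∀ v, c v ∈ T → ¬IsWordFix S c w v}

section Words

variable {κ : Type*} {n : ℕ}

theorem comp_succAbove_eq [PartialOrder κ] {c : Fin (n + 1) → κ} (hc : Monotone c)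
    {v₁ v₂ : Fin (n + 1)} (h : c v₁ = c v₂) : c ∘ v₁.succAbove = c ∘ v₂.succAbove := by
  wlog hle : v₁ ≤ v₂ generalizing v₁ v₂
  · exact (this h.symm (le_of_not_ge hle)).symm
  ext z
  simp only [Function.comp_apply]
  rcases lt_or_ge z.castSucc v₁ with h1 | h1
  · rw [Fin.succAbove_of_castSucc_lt _ _ h1, Fin.succAbove_of_castSucc_lt _ _ (h1.trans_le hle)]
  · rcases lt_or_ge z.castSucc v₂ with h2 | h2
    · rw [Fin.succAbove_of_le_castSucc _ _ h1, Fin.succAbove_of_castSucc_lt _ _ h2]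
      have a1 := hc h1
      have a2 := hc h2.le
      have a3 : c z.succ ≤ c v₂ := hc (by rw [Fin.le_def]; rw [Fin.lt_def] at h2; simpa using h2)
      have a4 : c z.castSucc ≤ c z.succ := hc z.castSucc_lt_succ.le
      exact le_antisymm (a3.trans (h ▸ a1)) a4
    · rw [Fin.succAbove_of_le_castSucc _ _ h1, Fin.succAbove_of_le_castSucc _ _ h2]

/-- The number of occurrences of the letter `i` in `w` before position `t`. -/
noncomputable def countBefore (w : Fin n → κ) (i : κ) (t : ℕ) : ℕ := #{u | u.val < t ∧ w u = i}

/-- The number of occurrences of the letter `i` in `w` from position `t` on. -/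
noncomputable def countFrom (w : Fin n → κ) (i : κ) (t : ℕ) : ℕ := #{u | t ≤ u.val ∧ w u = i}

theorem countBefore_succ (w : Fin n → κ) (i : κ) (v : Fin n) :
    countBefore w i (v + 1) = countBefore w i v + if w v = i then 1 else 0 := by
  unfold countBefore
  split_ifs with h
  · rw [← card_insert_of_notMem (a := v) (by simp)]
    congr 1
    ext u
    simp only [mem_filter, mem_univ, true_and, mem_insert]
    by_cases huv : u = v
    · subst huv; simp [h]
    · have := Fin.val_ne_of_ne huv
      simp only [huv, false_or]
      exact and_congr_left fun _ => by omega
  · rw [add_zero]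
    congr 1
    ext u
    simp only [mem_filter, mem_univ, true_and]
    by_cases huv : u = v
    · subst huv; simp [h]
    · have := Fin.val_ne_of_ne huv
      exact and_congr_left fun _ => by omega

theorem countBefore_add_countFrom (w : Fin n → κ) (i : κ) (t : ℕ) :
    countBefore w i t + countFrom w i t = #{u | w u = i} := by
  unfold countBefore countFrom
  rw [← Finset.card_filter_add_card_filter_not (s := {u | w u = i}) (fun u => u.val < t),
    filter_filter, filter_filter]
  simp only [and_comm, not_lt]

theorem countBefore_mono (w : Fin n → κ) (i : κ) : Monotone (countBefore w i) := by
  intro s t h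
  refine card_le_card fun u => ?_
  simp only [mem_filter, mem_univ, true_and]
  exact fun ⟨h1, h2⟩ => ⟨h1.trans_le h, h2⟩

theorem isWordFix_iff (S : Finset κ) (c w : Fin n → κ) (v : Fin n) :
    IsWordFix S c w v ↔ w v = c v ∧
      if c v ∈ S then countFrom w (c v) (v + 1) = countBefore c (c v) v
      else countBefore w (c v) v = countBefore c (c v) v := by
  rfl

section Removal

variable {c w : Fin (n + 1) → κ} {v : Fin (n + 1)}

theorem isWordFix_succAbove_iff (S : Finset κ) (hw : w v = c v) (z : Fin n)
    (hz : c (v.succAbove z) ≠ c v) :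
    IsWordFix S c w (v.succAbove z) ↔ IsWordFix S (c ∘ v.succAbove) (w ∘ v.succAbove) z := by
  unfold IsWordFix
  rw [Fin.card_filter_eq_add_succAbove v (fun u => v.succAbove z < u ∧ w u = c (v.succAbove z)),
    Fin.card_filter_eq_add_succAbove v (fun u => u < v.succAbove z ∧ w u = c (v.succAbove z)),
    Fin.card_filter_eq_add_succAbove v (fun u => u < v.succAbove z ∧ c u = c (v.succAbove z))]
  simp [hw, hz.symm, Fin.succAbove_lt_succAbove_iff]

theorem content_succAbove_iff (hw : w v = c v) :
    (∀ i, #{u | w u = i} = #{u | c u = i}) ↔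
      ∀ i, #{u | (w ∘ v.succAbove) u = i} = #{u | (c ∘ v.succAbove) u = i} := by
  refine forall_congr' fun i => ?_
  rw [Fin.card_filter_eq_add_succAbove v (fun u => w u = i),
    Fin.card_filter_eq_add_succAbove v (fun u => c u = i), hw]
  simp

theorem val_succAbove_lt_iff (z : Fin n) (t : ℕ) (ht : t ≤ v) :
    (v.succAbove z).val < t ↔ z.val < t := by
  rcases lt_or_ge z.castSucc v with h | h
  · rw [Fin.succAbove_of_castSucc_lt _ _ h]; simp
  · rw [Fin.succAbove_of_le_castSucc _ _ h]
    rw [Fin.le_def] at h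
    simp at h ⊢
    omega

theorem countBefore_succAbove (w : Fin (n + 1) → κ) (i : κ) (t : ℕ) (ht : t ≤ v) :
    countBefore w i t = countBefore (w ∘ v.succAbove) i t := by
  unfold countBefore
  rw [Fin.card_filter_eq_add_succAbove v]
  simp [val_succAbove_lt_iff _ t ht, ht.not_gt]

theorem countFrom_succAbove (w : Fin (n + 1) → κ) (i : κ) :
    countFrom w i (v + 1) = countFrom (w ∘ v.succAbove) i v := by
  unfold countFrom
  rw [Fin.card_filter_eq_add_succAbove v]
  have : ∀ z, v.val + 1 ≤ (v.succAbove z).val ↔ v.val ≤ z.val := by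
    intro z
    have := val_succAbove_lt_iff (v := v) z v le_rfl
    have := Fin.val_ne_of_ne (Fin.succAbove_ne v z)
    omega
  simp [this]

theorem isWordFix_self_iff (S : Finset κ) (hw : w v = c v) :
    IsWordFix S c w v ↔
      if c v ∈ S then countFrom (w ∘ v.succAbove) (c v) v = countBefore (c ∘ v.succAbove) (c v) v
      else countBefore (w ∘ v.succAbove) (c v) v = countBefore (c ∘ v.succAbove) (c v) v := by
  rw [isWordFix_iff, and_iff_right hw, countFrom_succAbove,
    countBefore_succAbove (v := v) w _ _ le_rfl, countBefore_succAbove (v := v) c _ _ le_rfl]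

end Removal

/-- The block of a letter in a monotone word is an interval; deleting one of its entries leaves
an interval shorter by one. -/
theorem exists_block_bounds [PartialOrder κ] {c : Fin (n + 1) → κ} (hc : Monotone c)
    {v : Fin (n + 1)} :
    ∃ s N : ℕ, (s + N ≤ n) ∧ (∀ u, c u = c v ↔ s ≤ u.val ∧ u.val ≤ s + N) ∧
      (∀ z, (c ∘ v.succAbove) z = c v ↔ s ≤ z.val ∧ z.val < s + N) ∧
      (∀ t, s ≤ t → t ≤ s + N → countBefore (c ∘ v.succAbove) (c v) t = t - s) ∧
      #{z | (c ∘ v.succAbove) z = c v} = N := by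
  set V : Finset (Fin (n + 1)) := {u | c u = c v} with hV
  have hne : V.Nonempty := ⟨v, by simp [hV]⟩
  set s := V.min' hne with hs
  set e := V.max' hne with he
  have hcs : c s = c v := by have := V.min'_mem hne; simpa [hV] using this
  have hce : c e = c v := by have := V.max'_mem hne; simpa [hV] using this
  have hse : s ≤ e := V.min'_le e (V.max'_mem hne)
  have hmem : ∀ u, c u = c v ↔ s ≤ u ∧ u ≤ e := by
    intro u
    constructor
    · intro h
      have hu : u ∈ V := by simpa [hV] using h
      exact ⟨V.min'_le u hu, V.le_max' u hu⟩
    · rintro ⟨h1, h2⟩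
      exact le_antisymm (hce ▸ hc h2) (hcs ▸ hc h1)
  have hmem' : ∀ z, (c ∘ v.succAbove) z = c v ↔ s.val ≤ z.val ∧ z.val < e.val := by
    intro z
    rw [← comp_succAbove_eq hc hcs, Function.comp_apply, hmem, Fin.le_def, Fin.le_def]
    rcases lt_or_ge z.castSucc s with h | h
    · rw [Fin.succAbove_of_castSucc_lt _ _ h]
      rw [Fin.lt_def] at h
      simp at h ⊢
      omega
    · rw [Fin.succAbove_of_le_castSucc _ _ h]
      rw [Fin.le_def] at h
      simp at h ⊢
      omega
  rw [Fin.le_def] at hse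
  have hcount : ∀ t, s.val ≤ t → t ≤ e.val →
      countBefore (c ∘ v.succAbove) (c v) t = t - s := by
    intro t h1 h2
    unfold countBefore
    rw [← Nat.card_Ico, ← Finset.card_map Fin.valEmbedding]
    congr 1
    ext y
    simp only [mem_map, mem_filter, mem_univ, true_and, hmem', mem_Ico, Fin.valEmbedding_apply]
    constructor
    · rintro ⟨z, ⟨h3, h4, h5⟩, rfl⟩; exact ⟨h4, h3⟩
    · rintro ⟨h3, h4⟩
      exact ⟨⟨y, by omega⟩, ⟨h4, h3, by simp only; omega⟩, rfl⟩
  refine ⟨s, e - s, by omega, fun u => ?_, fun z => ?_, fun t h1 h2 => hcount t h1 (by omega), ?_⟩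
  · rw [hmem, Fin.le_def, Fin.le_def]; omega
  · rw [hmem']; omega
  · rw [← hcount e hse le_rfl]
    unfold countBefore
    congr 1
    ext z
    simp only [mem_filter, mem_univ, true_and, hmem']
    omega

theorem countBefore_succ_le (w : Fin n → κ) (i : κ) (t : ℕ) :
    countBefore w i (t + 1) ≤ countBefore w i t + 1 := by
  rcases lt_or_ge t n with h | h
  · have := countBefore_succ w i ⟨t, h⟩
    simp only at this
    split_ifs at this <;> omega
  · refine le_trans (card_le_card fun u => ?_) (Nat.le_succ _)
    simp only [mem_filter, mem_univ, true_and]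
    exact fun ⟨_, h2⟩ => ⟨u.isLt.trans_le h, h2⟩

theorem countBefore_add_le (w : Fin n → κ) (i : κ) (t d : ℕ) :
    countBefore w i (t + d) ≤ countBefore w i t + d := by
  induction d with
  | zero => rfl
  | succ d ih => have := countBefore_succ_le w i (t + d); rw [← add_assoc]; omega

theorem countFrom_anti (w : Fin n → κ) (i : κ) {s t : ℕ} (h : s ≤ t) :
    countFrom w i t ≤ countFrom w i s := by
  have := countBefore_mono w i h
  have := countBefore_add_countFrom w i s
  have := countBefore_add_countFrom w i t
  omega

theorem exists_eq_sub_of_monotone {f : ℕ → ℕ} {s N : ℕ} (hf : Monotone f) (hN : f (s + N) ≤ N) :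
    ∃ t, s ≤ t ∧ t ≤ s + N ∧ f t = t - s := by
  have hex : ∃ d, f (s + d) ≤ d := ⟨N, hN⟩
  refine ⟨s + Nat.find hex, by omega, by have := Nat.find_min' hex hN; omega, ?_⟩
  have h1 := Nat.find_spec hex
  rcases hd : Nat.find hex with _ | d
  · rw [hd] at h1; omega
  · rw [hd] at h1
    have h2 : ¬f (s + d) ≤ d := Nat.find_min hex (by omega)
    have h3 : f (s + d) ≤ f (s + (d + 1)) := hf (by omega)
    omega

theorem exists_eq_sub_of_antitone {g : ℕ → ℕ} {s N : ℕ} (hN : g (s + N) ≤ N)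
    (hstep : ∀ t, g t ≤ g (t + 1) + 1)
    (hskip : ∀ t, s ≤ t → t < s + N → g t = g (t + 1) + 1 → g (t + 1) ≠ t - s) :
    ∃ t, s ≤ t ∧ t ≤ s + N ∧ g t = t - s := by
  have hex : ∃ d, g (s + d) ≤ d := ⟨N, hN⟩
  have hle := Nat.find_min' hex hN
  refine ⟨s + Nat.find hex, by omega, by omega, ?_⟩
  have h1 := Nat.find_spec hex
  rcases hd : Nat.find hex with _ | d
  · rw [hd] at h1; omega
  · rw [hd] at h1
    have h2 : ¬g (s + d) ≤ d := Nat.find_min hex (by omega)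
    have h3 := hstep (s + d)
    have h4 := hskip (s + d) (by omega) (by omega)
    rw [add_assoc] at h3 h4
    omega

theorem existsUnique_first {p : Fin n → Prop} (h : ∃ v, p v) :
    ∃! v, p v ∧ ∀ u < v, ¬p u := by
  obtain ⟨v, hv, hmin⟩ := WellFounded.has_min wellFounded_lt {v | p v} h
  refine ⟨v, ⟨hv, fun u hu hp => hmin u hp hu⟩, fun v' ⟨hv', hmin'⟩ => ?_⟩
  exact le_antisymm (not_lt.mp fun hlt => hmin' v hlt hv) (not_lt.mp (hmin v' hv'))

theorem card_eq_sum_card_of_existsUnique {α β : Type*} [Fintype β] {A : Finset α}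
    {P : β → α → Prop} (h : ∀ w ∈ A, ∃! v, P v w) : #A = ∑ v, #{w ∈ A | P v w} := by
  have h1 := Finset.sum_card_bipartiteAbove_eq_sum_card_bipartiteBelow (fun w v => P v w)
    (s := A) (t := univ)
  simp only [bipartiteAbove, bipartiteBelow] at h1
  rw [← h1, Finset.card_eq_sum_ones]
  refine Finset.sum_congr rfl fun w hw => ?_
  obtain ⟨v, hv, huniq⟩ := h w hw
  rw [eq_comm, Finset.card_eq_one]
  exact ⟨v, by ext v'; simpa using ⟨huniq v', fun h => h ▸ hv⟩⟩

/-- Inserting the letter `i` into `w` at position `v` creates a fixed point there. -/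
def IsInsertFix (S : Finset κ) (c w : Fin n → κ) (i : κ) (v : ℕ) : Prop :=
  if i ∈ S then countFrom w i v = countBefore c i v else countBefore w i v = countBefore c i v

theorem forall_mem_not_isWordFix_iff {c w : Fin (n + 1) → κ} {v : Fin (n + 1)} (S T : Finset κ)
    (hT : c v ∉ T) (hw : w v = c v) :
    (∀ u, c u ∈ T → ¬IsWordFix S c w u) ↔
      ∀ z, (c ∘ v.succAbove) z ∈ T → ¬IsWordFix S (c ∘ v.succAbove) (w ∘ v.succAbove) z := by
  rw [Fin.forall_iff_succAbove v]
  simp only [hT, false_imp_iff, true_and]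
  refine forall_congr' fun z => imp_congr_right fun hz => not_congr ?_
  exact isWordFix_succAbove_iff S hw z fun h => hT (h ▸ hz)

theorem not_isWordFix_of_isInsertFix [PartialOrder κ] {c : Fin (n + 1) → κ} (hc : Monotone c)
    {v : Fin (n + 1)} {S : Finset κ} (hS : c v ∈ S) {w : Fin n → κ}
    (hfix : IsInsertFix S (c ∘ v.succAbove) w (c v) v) (z : Fin n)
    (hz : (c ∘ v.succAbove) z = c v) : ¬IsWordFix S (c ∘ v.succAbove) w z := by
  obtain ⟨s, N, -, hblock, hblock', hcount, -⟩ := exists_block_bounds hc (v := v)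
  rw [isWordFix_iff, hz, if_pos hS]
  rintro ⟨h1, h2⟩
  rw [IsInsertFix, if_pos hS] at hfix
  have hv := (hblock v).mp rfl
  have hz' := (hblock' z).mp hz
  rw [hcount _ hv.1 hv.2] at hfix
  rw [hcount _ hz'.1 hz'.2.le] at h2
  have h3 := countBefore_succ w (c v) z
  rw [if_pos h1] at h3
  have h4 := countBefore_add_countFrom w (c v) z
  have h5 := countBefore_add_countFrom w (c v) (z + 1)
  rcases lt_or_ge z.val v.val with h | h
  · have := countFrom_anti w (c v) (show z.val + 1 ≤ v by omega)
    omega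
  · have := countFrom_anti w (c v) h
    omega

theorem forall_lt_not_isWordFix_iff [PartialOrder κ] {c w : Fin (n + 1) → κ} (hc : Monotone c)
    {v : Fin (n + 1)} (S : Finset κ)
    (hfix : IsInsertFix S (c ∘ v.succAbove) (w ∘ v.succAbove) (c v) v) :
    (∀ u < v, ¬(c u = c v ∧ IsWordFix S c w u)) ↔
      ∀ u < v, ¬(c u = c v ∧ IsInsertFix S (c ∘ v.succAbove) (w ∘ v.succAbove) (c v) u) := by
  obtain ⟨s, N, -, hblock, hblock', hcount, -⟩ := exists_block_bounds hc (v := v)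
  have hv := (hblock v).mp rfl
  refine forall₂_congr fun u hu => not_congr (and_congr_right fun hcu => ?_)
  have hu' := (hblock u).mp hcu
  rw [isWordFix_iff, hcu,
    countBefore_succAbove (v := v) c _ u.val (Fin.le_def.mp hu.le),
    countBefore_succAbove (v := v) w _ u.val (Fin.le_def.mp hu.le)]
  unfold IsInsertFix at hfix ⊢
  rw [Fin.lt_def] at hu
  rw [hcount _ hu'.1 hu'.2]
  rw [hcount _ hv.1 hv.2] at hfix
  by_cases hS : c v ∈ S
  · simp only [hS, if_true] at hfix ⊢
    have h1 := countFrom_anti (w ∘ v.succAbove) (c v) hu.le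
    have h2 := countFrom_anti w (c v) (show u.val + 1 ≤ v.val + 1 by omega)
    rw [countFrom_succAbove] at h2
    constructor
    · rintro ⟨-, h⟩; omega
    · intro h; omega
  · simp only [hS, if_false] at hfix ⊢
    refine and_iff_right_of_imp fun h => ?_
    by_contra hne
    obtain ⟨z, rfl⟩ := Fin.exists_succAbove_eq (show u ≠ v from fun h => by simp [h] at hu)
    have hzv : (v.succAbove z).val = z.val := by
      have := val_succAbove_lt_iff (v := v) z v le_rfl
      rw [Fin.succAbove_of_castSucc_lt]
      · rfl
      · rw [Fin.lt_def]; exact this.mp hu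
    have h3 := countBefore_succ (w ∘ v.succAbove) (c v) z
    rw [Function.comp_apply, if_neg hne] at h3
    rw [hzv] at hu hu' h
    have h4 := countBefore_add_le (w ∘ v.succAbove) (c v) (z + 1) (v - (z + 1))
    rw [show z.val + 1 + (v - (z + 1)) = v.val by omega] at h4
    omega

theorem exists_isInsertFix [PartialOrder κ] [Fintype κ] {c : Fin (n + 1) → κ} (hc : Monotone c)
    {v : Fin (n + 1)} (S T : Finset κ) {w : Fin n → κ}
    (hw : w ∈ derWords S (if c v ∈ S then insert (c v) T else T) (c ∘ v.succAbove)) :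
    ∃ u, c u = c v ∧ IsInsertFix S (c ∘ v.succAbove) w (c v) u := by
  obtain ⟨s, N, hn, hblock, hblock', hcount, hN⟩ := exists_block_bounds hc (v := v)
  simp only [derWords, mem_filter, mem_univ, true_and] at hw
  have htot := hw.1 (c v)
  rw [hN] at htot
  have hsplit := countBefore_add_countFrom w (c v)
  rw [htot] at hsplit
  suffices h : ∃ t, s ≤ t ∧ t ≤ s + N ∧ (if c v ∈ S then countFrom w (c v) t = t - s
      else countBefore w (c v) t = t - s) by
    obtain ⟨t, h1, h2, h3⟩ := h
    refine ⟨⟨t, by omega⟩, (hblock _).mpr ⟨h1, h2⟩, ?_⟩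
    unfold IsInsertFix
    rwa [hcount t h1 h2]
  by_cases hS : c v ∈ S
  · simp only [hS, if_true] at hw ⊢
    refine exists_eq_sub_of_antitone (by have := hsplit (s + N); omega) (fun t => ?_) ?_
    · have := hsplit t
      have := hsplit (t + 1)
      have := countBefore_succ_le w (c v) t
      omega
    · intro t h1 h2 h3 h4
      have hz := (hblock' ⟨t, by omega⟩).mpr ⟨h1, h2⟩
      refine hw.2 ⟨t, by omega⟩ (by rw [hz]; exact mem_insert_self _ _) ?_
      rw [isWordFix_iff, hz, if_pos hS, hcount _ h1 h2.le]
      refine ⟨?_, h4⟩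
      by_contra hne
      have h5 := countBefore_succ w (c v) ⟨t, by omega⟩
      rw [if_neg hne] at h5
      have := hsplit t
      have := hsplit (t + 1)
      simp only at h5
      omega
  · simp only [hS, if_false]
    exact exists_eq_sub_of_monotone (countBefore_mono w _) (by have := hsplit (s + N); omega)

theorem card_derWords_recursion [PartialOrder κ] [Fintype κ] {c : Fin (n + 1) → κ}
    (hc : Monotone c) (v₀ : Fin (n + 1)) (S T : Finset κ) (hT : c v₀ ∉ T) :
    #(derWords S T c) = #(derWords S (insert (c v₀) T) c) +
      #(derWords S (if c v₀ ∈ S then insert (c v₀) T else T) (c ∘ v₀.succAbove)) := by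
  have hins : ∀ {m : ℕ} (d : Fin m → κ), derWords S (insert (c v₀) T) d =
      {w ∈ derWords S T d | ¬∃ u, d u = c v₀ ∧ IsWordFix S d w u} := by
    intro m d
    ext w
    simp only [derWords, mem_filter, mem_univ, true_and, mem_insert, or_imp, forall_and,
      not_exists, not_and]
    tauto
  rw [← Finset.card_filter_add_card_filter_not (s := derWords S T c)
    (fun w => ∃ u, c u = c v₀ ∧ IsWordFix S c w u), ← hins, add_comm]
  congr 1
  have hA' : ∀ {v} (_ : c v = c v₀) w,
      w ∈ derWords S (if c v₀ ∈ S then insert (c v₀) T else T) (c ∘ v₀.succAbove) ↔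
      w ∈ derWords S T (c ∘ v.succAbove) ∧ (c v ∈ S → ∀ z, (c ∘ v.succAbove) z = c v →
        ¬IsWordFix S (c ∘ v.succAbove) w z) := by
    intro v hv w
    rw [comp_succAbove_eq hc hv, hv]
    split_ifs with h
    · rw [hins]; simp [h]
    · simp [h]
  rw [card_eq_sum_card_of_existsUnique
      (P := fun v w => (c v = c v₀ ∧ IsWordFix S c w v) ∧
        ∀ u < v, ¬(c u = c v₀ ∧ IsWordFix S c w u))
      (fun w hw => existsUnique_first (mem_filter.mp hw).2),
    card_eq_sum_card_of_existsUnique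
      (P := fun (v : Fin (n + 1)) w =>
        (c v = c v₀ ∧ IsInsertFix S (c ∘ v₀.succAbove) w (c v₀) v) ∧
        ∀ u < v, ¬(c u = c v₀ ∧ IsInsertFix S (c ∘ v₀.succAbove) w (c v₀) u))
      (fun w hw => existsUnique_first (p := fun v : Fin (n + 1) =>
        c v = c v₀ ∧ IsInsertFix S (c ∘ v₀.succAbove) w (c v₀) v) (exists_isInsertFix hc S T hw))]
  refine Finset.sum_congr rfl fun v _ => ?_
  by_cases hv : c v = c v₀
  swap
  · simp [hv]
  have key : ∀ w : Fin (n + 1) → κ, w v = c v →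
      ((w ∈ derWords S T c ∧ (c v = c v₀ ∧ IsWordFix S c w v) ∧
        ∀ u < v, ¬(c u = c v₀ ∧ IsWordFix S c w u)) ↔
      (w ∘ v.succAbove ∈
        derWords S (if c v₀ ∈ S then insert (c v₀) T else T) (c ∘ v₀.succAbove) ∧
        (c v = c v₀ ∧ IsInsertFix S (c ∘ v₀.succAbove) (w ∘ v.succAbove) (c v₀) v) ∧
        ∀ u < v, ¬(c u = c v₀ ∧
          IsInsertFix S (c ∘ v₀.succAbove) (w ∘ v.succAbove) (c v₀) u))) := by
    intro w hwv
    rw [hA' hv, ← comp_succAbove_eq hc hv, ← hv, isWordFix_self_iff S hwv]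
    simp only [derWords, mem_filter, mem_univ, true_and]
    rw [content_succAbove_iff hwv, forall_mem_not_isWordFix_iff S T (hv ▸ hT) hwv]
    change _ ∧ (IsInsertFix S (c ∘ v.succAbove) (w ∘ v.succAbove) (c v) v ∧ _) ↔ _
    by_cases hfix : IsInsertFix S (c ∘ v.succAbove) (w ∘ v.succAbove) (c v) v
    · rw [forall_lt_not_isWordFix_iff hc S hfix]
      have := fun hS => not_isWordFix_of_isInsertFix hc (S := S) hS hfix
      tauto
    · tauto
  have hdrop : ∀ w, (w ∈ derWords S T c ∧ ∃ u, c u = c v₀ ∧ IsWordFix S c w u) ∧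
      ((c v = c v₀ ∧ IsWordFix S c w v) ∧ ∀ u < v, ¬(c u = c v₀ ∧ IsWordFix S c w u)) ↔
      (w ∈ derWords S T c ∧ (c v = c v₀ ∧ IsWordFix S c w v) ∧
        ∀ u < v, ¬(c u = c v₀ ∧ IsWordFix S c w u)) := by
    intro w
    constructor
    · rintro ⟨⟨h1, -⟩, h2⟩; exact ⟨h1, h2⟩
    · rintro ⟨h1, h2⟩; exact ⟨⟨h1, v, h2.1⟩, h2⟩
  refine Finset.card_nbij' (fun w => w ∘ v.succAbove) (fun w' => v.insertNth (c v) w') ?_ ?_ ?_ ?_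
  · intro w hw
    simp only [coe_filter, mem_filter, Set.mem_ofPred_eq] at hw ⊢
    rw [hdrop] at hw
    exact (key w hw.2.1.2.1).mp hw
  · intro w' hw'
    simp only [coe_filter, mem_filter, Set.mem_ofPred_eq] at hw' ⊢
    rw [hdrop]
    refine (key _ (by simp)).mpr ?_
    convert hw' <;> (ext z; simp)
  · intro w hw
    simp only [coe_filter, mem_filter, Set.mem_ofPred_eq] at hw
    rw [hdrop] at hw
    ext u
    rcases Fin.eq_self_or_eq_succAbove v u with rfl | ⟨z, rfl⟩
    · simp [hw.2.1.2.1]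
    · simp
  · intro w' _
    ext z
    simp

end Words

section Assembly

variable {κ : Type*} {n : ℕ}

theorem exists_comp_perm_eq {c w : Fin n → κ} (h : ∀ i, #{u | w u = i} = #{u | c u = i}) :
    ∃ τ : Equiv.Perm (Fin n), c ∘ τ = w := by
  have e : ∀ i, Nonempty ({x // w x = i} ≃ {x // c x = i}) := fun i =>
    Fintype.card_eq.mp (by simpa [Fintype.card_subtype] using h i)
  exact ⟨Equiv.ofFiberEquiv fun i => (e i).some, funext fun x => Equiv.ofFiberEquiv_map _ x⟩

theorem card_content_words [Fintype κ] (S : Finset κ) (c : Fin n → κ) :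
    n.factorial = (∏ i, (#{x | c x = i}).factorial) * #(derWords S ∅ c) := by
  have h := Finset.card_eq_sum_card_fiberwise (s := (univ : Finset (Equiv.Perm (Fin n))))
    (f := fun τ : Equiv.Perm (Fin n) => c ∘ ⇑τ) (t := derWords S ∅ c) (by
      intro τ _
      simp only [derWords, notMem_empty, false_imp_iff, imp_true_iff, and_true, coe_filter,
        mem_univ, true_and, Set.mem_ofPred_eq]
      exact fun i => Finset.card_equiv τ (by simp))
  rw [card_univ, Fintype.card_perm, Fintype.card_fin] at h
  rw [h, Finset.sum_congr rfl (g := fun _ => ∏ i, (#{x | c x = i}).factorial), sum_const,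
    smul_eq_mul, mul_comm]
  intro w hw
  simp only [derWords, notMem_empty, false_imp_iff, imp_true_iff, and_true, mem_filter,
    mem_univ, true_and] at hw
  obtain ⟨τ, rfl⟩ := exists_comp_perm_eq hw
  have hs := DomMulAct.stabilizer_card c
  simp only [Fintype.card_subtype] at hs
  rw [← hs]
  symm
  refine Finset.card_equiv (Equiv.mulRight τ) fun g => ?_
  simp only [mem_filter, mem_univ, true_and, Equiv.coe_mulRight, Equiv.Perm.coe_mul]
  rw [← Function.comp_assoc]
  exact ⟨fun h => by rw [h], fun h => τ.surjective.injective_comp_right h⟩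

theorem prod_factorial_succAbove [Fintype κ] (c : Fin (n + 1) → κ) (v : Fin (n + 1)) :
    ∏ i, (#{x | c x = i}).factorial =
      #{x | c x = c v} * ∏ i, (#{x | (c ∘ v.succAbove) x = i}).factorial := by
  rw [← mul_prod_erase univ _ (mem_univ (c v)),
    ← mul_prod_erase univ (fun i => (#{x | (c ∘ v.succAbove) x = i}).factorial) (mem_univ (c v)),
    ← mul_assoc]
  congr 1
  · rw [Fin.card_filter_eq_add_succAbove v, if_pos rfl, add_comm, Nat.factorial_succ]
    rfl
  · refine prod_congr rfl fun i hi => ?_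
    rw [Fin.card_filter_eq_add_succAbove v, if_neg (ne_of_mem_erase hi).symm, zero_add]
    rfl

theorem card_evenPerms_eq [PartialOrder κ] [Fintype κ] (S T : Finset κ) (c : Fin n → κ)
    (hc : Monotone c) :
    #(evenPerms S T c) = (∏ i, (#{x | c x = i}).factorial) * #(derWords S T c) := by
  induction n generalizing T with
  | zero =>
    have h1 : evenPerms S T c = univ := by
      ext τ
      have : ∀ i, smallSet c τ i = ∅ := fun i => Subsingleton.elim _ _
      simp [evenPerms, SmallCond, this]
    have h2 : derWords S T c = derWords S ∅ c := by
      ext w; simp [derWords]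
    rw [h1, h2, ← card_content_words, card_univ, Fintype.card_perm, Fintype.card_fin]
  | succ n ih =>
    induction T using Finset.induction_on with
    | empty =>
      have h1 : evenPerms S ∅ c = univ := by ext τ; simp [evenPerms]
      rw [h1, ← card_content_words, card_univ, Fintype.card_perm, Fintype.card_fin]
    | insert i T hi ihT =>
      by_cases hex : ∃ v, c v = i
      · obtain ⟨v, rfl⟩ := hex
        have h1 := card_evenPerms_recursion S T hi
          (fun x (hx : c x = c v) => comp_succAbove_eq hc hx)
        have h2 := card_derWords_recursion hc v S T hi
        rw [ihT, h2, ih _ (c ∘ v.succAbove) (hc.comp (Fin.strictMono_succAbove v).monotone),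
          mul_add, ← mul_assoc, ← prod_factorial_succAbove] at h1
        exact (Nat.add_right_cancel h1).symm
      · push Not at hex
        have h1 : evenPerms S (insert i T) c = evenPerms S T c := by
          ext τ
          have : smallSet c τ i = ∅ :=
            eq_empty_of_forall_notMem fun v hv => hex v (color_of_mem_smallSet hv)
          simp [evenPerms, SmallCond, this]
        have h2 : derWords S (insert i T) c = derWords S T c := by
          ext w; simp [derWords, hex]
        rw [h1, h2, ihT]

/-- The number of occurrences of `i` in `w` after `x` if `i ∈ S`, before `x` otherwise. -/
noncomputable def wordRank (S : Finset κ) (w : Fin n → κ) (i : κ) (x : Fin n) : ℕ :=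
  if i ∈ S then #{u | x < u ∧ w u = i} else #{u | u < x ∧ w u = i}

/-- `π` is decreasing on the blocks of `c` in `S` and increasing on the other ones. -/
def IsBlockSorted (S : Finset κ) (c : Fin n → κ) (π : Equiv.Perm (Fin n)) : Prop :=
  ∀ u v, u < v → c u = c v → if c u ∈ S then π v < π u else π u < π v

theorem isWordFix_iff_wordRank (S : Finset κ) (c w : Fin n → κ) (v : Fin n) :
    IsWordFix S c w v ↔ w v = c v ∧ wordRank S w (c v) v = #{u | u < v ∧ c u = c v} := by
  unfold IsWordFix wordRank
  split_ifs <;> rfl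

theorem wordRank_injective (S : Finset κ) (w : Fin n → κ) {i : κ} {x y : Fin n} (hx : w x = i)
    (hy : w y = i) (h : wordRank S w i x = wordRank S w i y) : x = y := by
  wlog hlt : x < y generalizing x y
  · rcases lt_trichotomy x y with h1 | h1 | h1
    · exact this hx hy h h1
    · exact h1
    · exact (this hy hx h.symm h1).symm
  exfalso
  unfold wordRank at h
  split_ifs at h
  · refine (card_lt_card (ssubset_iff_of_subset ?_ |>.mpr ⟨y, ?_, ?_⟩)).ne' h
    · intro u
      simp only [mem_filter, mem_univ, true_and]
      exact fun ⟨h1, h2⟩ => ⟨hlt.trans h1, h2⟩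
    · simp [hlt, hy]
    · simp
  · refine (card_lt_card (ssubset_iff_of_subset ?_ |>.mpr ⟨x, ?_, ?_⟩)).ne h
    · intro u
      simp only [mem_filter, mem_univ, true_and]
      exact fun ⟨h1, h2⟩ => ⟨h1.trans hlt, h2⟩
    · simp [hlt, hx]
    · simp

theorem IsBlockSorted.wordRank_apply {S : Finset κ} {c : Fin n → κ} {π : Equiv.Perm (Fin n)}
    (h : IsBlockSorted S c π) (u : Fin n) :
    wordRank S (c ∘ π.symm) (c u) (π u) = #{y | y < u ∧ c y = c u} := by
  unfold wordRank
  split_ifs with hS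
  · symm
    refine Finset.card_equiv π fun y => ?_
    simp only [mem_filter, mem_univ, true_and, Function.comp_apply, Equiv.symm_apply_apply]
    refine and_congr_left fun hy => ?_
    rcases lt_trichotomy y u with h1 | rfl | h1
    · have := h y u h1 hy
      rw [if_pos (hy ▸ hS)] at this
      simp [h1, this]
    · simp
    · have := h u y h1 hy.symm
      rw [if_pos hS] at this
      simp [h1.not_gt, this.not_gt]
  · symm
    refine Finset.card_equiv π fun y => ?_
    simp only [mem_filter, mem_univ, true_and, Function.comp_apply, Equiv.symm_apply_apply]
    refine and_congr_left fun hy => ?_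
    rcases lt_trichotomy y u with h1 | rfl | h1
    · have := h y u h1 hy
      rw [if_neg (hy ▸ hS)] at this
      simp [h1, this]
    · simp
    · have := h u y h1 hy.symm
      rw [if_neg hS] at this
      simp [h1.not_gt, this.not_gt]

theorem IsBlockSorted.isWordFix_iff {S : Finset κ} {c : Fin n → κ} {π : Equiv.Perm (Fin n)}
    (h : IsBlockSorted S c π) (v : Fin n) : IsWordFix S c (c ∘ π.symm) v ↔ π v = v := by
  rw [isWordFix_iff_wordRank, ← h.wordRank_apply]
  constructor
  · rintro ⟨h1, h2⟩
    exact (wordRank_injective S (c ∘ π.symm) h1 (by simp) h2).symm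
  · intro hv
    refine ⟨?_, by rw [hv]⟩
    rw [Function.comp_apply, π.symm_apply_eq.mpr hv.symm]

theorem exists_isBlockSorted (S : Finset κ) {c w : Fin n → κ}
    (h : ∀ i, #{u | w u = i} = #{u | c u = i}) :
    ∃ π : Equiv.Perm (Fin n), IsBlockSorted S c π ∧ c ∘ π.symm = w := by
  have e : ∀ i, ∃ e : {x // c x = i} ≃ {x // w x = i}, ∀ x y, x < y →
      if i ∈ S then e y < e x else e x < e y := by
    intro i
    have hi := h i
    let f := Fintype.orderIsoFinOfCardEq {x // c x = i} (k := #{u | c u = i})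
      (by simp [Fintype.card_subtype])
    let g := Fintype.orderIsoFinOfCardEq {x // w x = i} (k := #{u | c u = i})
      (by simpa [Fintype.card_subtype] using hi)
    by_cases hS : i ∈ S
    · exact ⟨(f.symm.toEquiv.trans Fin.revPerm).trans g.toEquiv, fun x y hxy => by simpa [hS]⟩
    · exact ⟨f.symm.toEquiv.trans g.toEquiv, fun x y hxy => by simpa [hS]⟩
  choose e he using e
  have hval : ∀ i u (hu : c u = i), Equiv.ofFiberEquiv e u = e i ⟨u, hu⟩ := by
    rintro i u rfl
    rfl
  refine ⟨Equiv.ofFiberEquiv e, fun u v huv hc => ?_, ?_⟩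
  · rw [hval (c u) u rfl, hval (c u) v hc.symm]
    exact he (c u) ⟨u, rfl⟩ ⟨v, hc.symm⟩ huv
  · ext x
    obtain ⟨u, rfl⟩ := (Equiv.ofFiberEquiv e).surjective x
    rw [Function.comp_apply, Equiv.symm_apply_apply]
    exact (Equiv.ofFiberEquiv_map e u).symm

theorem card_sorted_derangements [Fintype κ] (S : Finset κ) (c : Fin n → κ) :
    #{π : Equiv.Perm (Fin n) | IsBlockSorted S c π ∧ ∀ x, π x ≠ x} = #(derWords S univ c) := by
  refine Finset.card_nbij (fun π => c ∘ π.symm) ?_ ?_ ?_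
  · intro π hπ
    simp only [coe_filter, mem_univ, true_and, Set.mem_ofPred_eq] at hπ
    simp only [derWords, coe_filter, mem_univ, true_and, Set.mem_ofPred_eq, hπ.1.isWordFix_iff]
    exact ⟨fun i => Finset.card_equiv π.symm (by simp), fun v _ => hπ.2 v⟩
  · intro π hπ π' hπ' heq
    simp only [coe_filter, mem_univ, true_and, Set.mem_ofPred_eq] at hπ hπ' heq
    ext1 u
    have h2 := hπ'.1.wordRank_apply u
    rw [← heq] at h2
    refine wordRank_injective S (c ∘ π.symm) (i := c u) (by simp) (by rw [heq]; simp) ?_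
    rw [hπ.1.wordRank_apply, h2]
  · intro w hw
    simp only [derWords, coe_filter, mem_univ, true_and, Set.mem_ofPred_eq] at hw
    obtain ⟨π, hπ, rfl⟩ := exists_isBlockSorted S hw.1
    refine ⟨π, ?_, rfl⟩
    simp only [coe_filter, mem_univ, true_and, Set.mem_ofPred_eq]
    exact ⟨hπ, fun x hx => hw.2 x trivial ((hπ.isWordFix_iff x).mpr hx)⟩

end Assembly

section Blocks

variable {k : ℕ} (a : Fin k → ℕ)

theorem blockStart_add_eq_sum_Iic (i : Fin k) : blockStart a i + a i = ∑ t ∈ Iic i, a t := by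
  unfold blockStart
  rw [← Finset.Iio_insert i, sum_insert (by simp), add_comm]

theorem blockStart_add_le {i j : Fin k} (h : i < j) : blockStart a i + a i ≤ blockStart a j := by
  rw [blockStart_add_eq_sum_Iic]
  refine sum_le_sum_of_subset fun t ht => ?_
  rw [mem_Iic] at ht
  exact mem_Iio.mpr (ht.trans_lt h)

theorem blockStart_add_le_sum (i : Fin k) : blockStart a i + a i ≤ ∑ t, a t := by
  rw [blockStart_add_eq_sum_Iic]
  exact sum_le_sum_of_subset (subset_univ _)

theorem exists_inBlock {x : ℕ} (hx : x < ∑ t, a t) : ∃ i, inBlock a i x := by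
  have hne : ∃ i, x < blockStart a i + a i := by
    rcases k with _ | k
    · simp at hx
    · refine ⟨Fin.last k, ?_⟩
      rw [blockStart_add_eq_sum_Iic]
      convert hx using 2
      ext t
      simp [Fin.le_last]
  obtain ⟨i, hi, hmin⟩ := WellFounded.has_min wellFounded_lt {i | x < blockStart a i + a i} hne
  refine ⟨i, ?_, hi⟩
  rcases Nat.eq_zero_or_pos i.val with h0 | hpos
  · have : Iio i = ∅ := by
      ext t
      simp [Fin.lt_def, h0]
    simp [blockStart, this]
  · let j : Fin k := ⟨i - 1, by omega⟩
    have hj : blockStart a j + a j ≤ x :=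
      not_lt.mp fun h => hmin j h (by rw [Fin.lt_def]; simp only [j]; omega)
    rw [blockStart_add_eq_sum_Iic] at hj
    unfold blockStart
    convert hj using 2
    ext t
    simp only [mem_Iio, mem_Iic, Fin.lt_def, Fin.le_def, j]
    omega

/-- The index of the block that contains `x`. -/
noncomputable def blockIndex (x : Fin (∑ t, a t)) : Fin k := (exists_inBlock a x.isLt).choose

theorem inBlock_blockIndex (x : Fin (∑ t, a t)) : inBlock a (blockIndex a x) x :=
  (exists_inBlock a x.isLt).choose_spec

theorem blockIndex_monotone : Monotone (blockIndex a) := by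
  intro x y hxy
  by_contra! h
  have h1 := blockStart_add_le a h
  have h2 := (inBlock_blockIndex a x).1
  have h3 := (inBlock_blockIndex a y).2
  rw [Fin.le_def] at hxy
  omega

theorem inBlock_iff (i : Fin k) (x : Fin (∑ t, a t)) : inBlock a i x ↔ blockIndex a x = i := by
  refine ⟨fun h => ?_, fun h => h ▸ inBlock_blockIndex a x⟩
  obtain ⟨h1, h2⟩ := inBlock_blockIndex a x
  rcases lt_trichotomy (blockIndex a x) i with hlt | heq | hlt
  · have := blockStart_add_le a hlt
    have := h.1
    omega
  · exact heq
  · have := blockStart_add_le a hlt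
    have := h.2
    omega

theorem card_blockIndex_eq (i : Fin k) : #{x | blockIndex a x = i} = a i := by
  have hle := blockStart_add_le_sum a i
  simp only [← inBlock_iff]
  rw [← Finset.card_map Fin.valEmbedding]
  have : map Fin.valEmbedding {x : Fin (∑ t, a t) | inBlock a i x} =
      Ico (blockStart a i) (blockStart a i + a i) := by
    ext y
    simp only [mem_map, mem_filter, mem_univ, true_and, mem_Ico, Fin.valEmbedding_apply]
    constructor
    · rintro ⟨z, hz, rfl⟩; exact hz
    · intro hy; exact ⟨⟨y, by omega⟩, hy, rfl⟩
  rw [this, Nat.card_Ico]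
  omega

theorem appl_val {n : ℕ} (π : Equiv.Perm (Fin n)) (x : Fin n) : appl π x = π x := by
  simp [appl]

theorem isASPerm_iff (S : Finset (Fin k)) (π : Equiv.Perm (Fin (∑ t, a t))) :
    IsASPerm a S π ↔ IsBlockSorted S (blockIndex a) π := by
  constructor
  · intro h u v huv hc
    have hu := inBlock_blockIndex a u
    have hv : inBlock a (blockIndex a u) v := (inBlock_iff a _ v).mpr hc.symm
    obtain ⟨d, hd⟩ : ∃ d, v.val = u.val + d + 1 :=
      ⟨v - u - 1, by rw [Fin.lt_def] at huv; omega⟩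
    have key : ∀ d, u.val + d + 1 < blockStart a (blockIndex a u) + a (blockIndex a u) →
        if blockIndex a u ∈ S then appl π (u + d + 1) < appl π u
        else appl π u < appl π (u + d + 1) := by
      intro d
      induction d with
      | zero => intro hlt; exact h _ _ hu.1 hlt
      | succ d ih =>
        intro hlt
        have h1 := ih (by omega)
        have h2 := h _ (u + d + 1) (by have := hu.1; omega) hlt
        rw [← add_assoc]
        split_ifs at h1 h2 ⊢
        · exact h2.trans h1
        · exact h1.trans h2
    have hk := key d (hd ▸ hv.2)
    rw [← hd, appl_val, appl_val] at hk
    simpa only [Fin.lt_def] using hk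
  · intro h i j h1 h2
    have hle := blockStart_add_le_sum a i
    have hj : blockIndex a ⟨j, by omega⟩ = i := (inBlock_iff a _ _).mp ⟨h1, by simp only; omega⟩
    have hj' : blockIndex a ⟨j + 1, by omega⟩ = i :=
      (inBlock_iff a _ _).mp ⟨by simp only; omega, h2⟩
    have hs := h ⟨j, by omega⟩ ⟨j + 1, by omega⟩ (by simp [Fin.lt_def]) (hj.trans hj'.symm)
    rw [hj] at hs
    simp only [Fin.lt_def, ← appl_val] at hs
    split_ifs at hs ⊢ <;> exact hs

theorem numDer_eq (S : Finset (Fin k)) : numDer k a S = #(derWords S univ (blockIndex a)) := by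
  rw [← card_sorted_derangements, numDer, Nat.card_eq_fintype_card, Fintype.card_subtype]
  simp only [isASPerm_iff]

theorem mem_smallSet_of_apply_eq {i : Fin k} {π : Equiv.Perm (Fin (∑ t, a t))}
    {x : Fin (∑ t, a t)} (hx : π x = x) :
    x ∈ smallSet (blockIndex a) π i ↔ inBlock a i x := by
  refine ⟨fun h => (inBlock_iff a i x).mpr (color_of_mem_smallSet h), fun h => ?_⟩
  simp only [smallSet, mem_filter, mem_univ, true_and]
  intro y hy
  rw [← hy.eq_of_left hx]
  exact (inBlock_iff a i x).mp h

theorem mem_smallSet_of_mem_support {i : Fin k} {π : Equiv.Perm (Fin (∑ t, a t))}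
    {c : Equiv.Perm (Fin (∑ t, a t))} (hc : c ∈ π.cycleFactorsFinset)
    {x : Fin (∑ t, a t)} (hx : x ∈ c.support) :
    x ∈ smallSet (blockIndex a) π i ↔ ∀ y ∈ c.support, inBlock a i y := by
  have hxπ : x ∈ π.support := Equiv.Perm.mem_cycleFactorsFinset_support_le hc hx
  rw [Equiv.Perm.cycle_is_cycleOf hx hc]
  simp only [smallSet, mem_filter, mem_univ, true_and, Equiv.Perm.mem_support_cycleOf_iff,
    inBlock_iff, hxπ, and_true]

theorem totalSmallLen_eq (i : Fin k) (π : Equiv.Perm (Fin (∑ t, a t))) :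
    totalSmallLen a i π = #(smallSet (blockIndex a) π i) := by
  rw [totalSmallLen, Nat.card_eq_fintype_card, Fintype.card_subtype,
    ← Finset.card_filter_add_card_filter_not (s := smallSet (blockIndex a) π i)
      (fun x => π x = x), ← Finset.card_biUnion]
  · congr 2
    · ext x
      simp only [mem_filter, mem_univ, true_and]
      rw [and_comm]
      exact and_congr_left fun hx => (mem_smallSet_of_apply_eq a hx).symm
    · ext x
      simp only [mem_biUnion, mem_filter]
      constructor
      · rintro ⟨c, ⟨hc, hcb⟩, hx⟩
        exact ⟨(mem_smallSet_of_mem_support a hc hx).mpr hcb, Equiv.Perm.mem_support.mp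
          (Equiv.Perm.mem_cycleFactorsFinset_support_le hc hx)⟩
      · rintro ⟨hx, hne⟩
        have hxπ : x ∈ π.support := Equiv.Perm.mem_support.mpr hne
        have hc := Equiv.Perm.cycleOf_mem_cycleFactorsFinset_iff.mpr hxπ
        have hxc : x ∈ (π.cycleOf x).support :=
          Equiv.Perm.mem_support_cycleOf_iff.mpr ⟨Equiv.Perm.SameCycle.refl _ _, hxπ⟩
        exact ⟨_, ⟨hc, (mem_smallSet_of_mem_support a hc hxc).mp hx⟩, hxc⟩
  · intro c hc d hd hcd
    exact (π.cycleFactorsFinset_pairwise_disjoint (mem_filter.mp hc).1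
      (mem_filter.mp hd).1 hcd).disjoint_support

theorem smallSet_eq_empty_iff (i : Fin k) (π : Equiv.Perm (Fin (∑ t, a t))) :
    smallSet (blockIndex a) π i = ∅ ↔ (∀ x, π x = x → ¬inBlock a i x) ∧
      ∀ c ∈ π.cycleFactorsFinset, ¬∀ x ∈ c.support, inBlock a i x := by
  constructor
  · intro h
    refine ⟨fun x hx hb => ?_, fun c hc hb => ?_⟩
    · have := (mem_smallSet_of_apply_eq a hx).mpr hb
      simp [h] at this
    · obtain ⟨x, hx⟩ := (Equiv.Perm.mem_cycleFactorsFinset_iff.mp hc).1.nonempty_support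
      have := (mem_smallSet_of_mem_support a hc hx).mpr hb
      simp [h] at this
  · rintro ⟨h1, h2⟩
    refine eq_empty_of_forall_notMem fun x hx => ?_
    by_cases hfix : π x = x
    · exact h1 x hfix ((mem_smallSet_of_apply_eq a hfix).mp hx)
    · have hxπ : x ∈ π.support := Equiv.Perm.mem_support.mpr hfix
      have hc := Equiv.Perm.cycleOf_mem_cycleFactorsFinset_iff.mpr hxπ
      exact h2 _ hc ((mem_smallSet_of_mem_support a hc
        (Equiv.Perm.mem_support_cycleOf_iff.mpr ⟨Equiv.Perm.SameCycle.refl _ _, hxπ⟩)).mp hx)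

theorem mem_evenPerms_univ_iff (S : Finset (Fin k)) (π : Equiv.Perm (Fin (∑ t, a t))) :
    π ∈ evenPerms S univ (blockIndex a) ↔
      (∀ x, π x = x → ∀ i, i ∉ S → ¬inBlock a i (x : ℕ)) ∧
        (∀ c ∈ π.cycleFactorsFinset, ∀ i, i ∉ S →
          ¬∀ x ∈ c.support, inBlock a i (x : ℕ)) ∧
        ∀ i ∈ S, Even (totalSmallLen a i π) := by
  have h1 : π ∈ evenPerms S univ (blockIndex a) ↔
      (∀ i ∉ S, smallSet (blockIndex a) π i = ∅) ∧ ∀ i ∈ S, Even (totalSmallLen a i π) := by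
    simp only [evenPerms, mem_filter, mem_univ, true_and, true_imp_iff, SmallCond,
      totalSmallLen_eq]
    constructor
    · intro h
      exact ⟨fun i hi => by simpa [hi] using h i, fun i hi => by simpa [hi] using h i⟩
    · rintro ⟨h1, h2⟩ i
      by_cases hi : i ∈ S
      · simpa [hi] using h2 i hi
      · simpa [hi] using h1 i hi
  rw [h1, ← and_assoc]
  simp only [smallSet_eq_empty_iff]
  refine and_congr_left fun _ => ⟨fun h => ⟨fun x hx i hi => (h i hi).1 x hx,
    fun c hc i hi => (h i hi).2 c hc⟩, fun h i hi => ⟨fun x hx => h.1 x hx i hi,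
    fun c hc => h.2 c hc i hi⟩⟩

end Blocks

end SmallCycles

/-- Let `D` be the number of `(A,S)`-derangements and `E` the number of
permutations with no small cycle in an ascending block and, for each descending
block, an even total length of small cycles in that block. Then
`E = a₁!⋯a_k!·D`. -/
theorem card_even_small_cycles_eq (k : ℕ) (a : Fin k → ℕ) (S : Finset (Fin k)) :
    Nat.card {π : Equiv.Perm (Fin (∑ t, a t)) //
        (∀ x, π x = x → ∀ i, i ∉ S → ¬inBlock a i (x : ℕ)) ∧
        (∀ c ∈ π.cycleFactorsFinset, ∀ i, i ∉ S →
          ¬∀ x ∈ c.support, inBlock a i (x : ℕ)) ∧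
        ∀ i ∈ S, Even (totalSmallLen a i π)}
      = (∏ i, (a i).factorial) * numDer k a S := by
  have h : _ = (evenPerms S Finset.univ (blockIndex a)).card :=
    Nat.subtype_card _ (mem_evenPerms_univ_iff a S)
  rw [h, card_evenPerms_eq S Finset.univ _ (blockIndex_monotone a), numDer_eq]
  congr 1
  refine Finset.prod_congr rfl fun i _ => ?_
  rw [← card_blockIndex_eq a i]
  congr!
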